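/- (Remark 4, dominance for pure variance minimization) Let y ∈ ℝ and let d̃* ∈ D be a policy minimizing the pseudo variance at y over D, i.e. σ̃^{d̃*}(y) ≤ σ̃^d(y) for all d ∈ D. If a policy d ∈ D satisfies μ^d ∈ [y − |y − μ^{d̃*}|, y + |y − μ^{d̃*}|] (equivalently |μ^d − y| ≤ |μ^{d̃*} − y|), then σ^{d̃*} ≤ σ^d. -/

import Mathlib

open Finset

/-- The steady-state mean `μ = ∑ i, π i * r i` of a reward vector `r` under a
probability vector `π`. -/
def mdpMean {S : Type*} [Fintype S] (π r : S → ℝ) : ℝ := ∑ i, π i * r i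

/-- The steady-state variance `σ = ∑ i, π i * (r i - μ)²`. -/
def mdpVar {S : Type*} [Fintype S] (π r : S → ℝ) : ℝ :=
  ∑ i, π i * (r i - mdpMean π r)^2

/-- The pseudo variance `σ̃(y) = ∑ i, π i * (r i - y)²` with pseudo mean `y`. -/
def mdpPseudoVar {S : Type*} [Fintype S] (π r : S → ℝ) (y : ℝ) : ℝ :=
  ∑ i, π i * (r i - y)^2

/-- The mean-variance objective `η = β·σ - μ`. -/
def mdpEta {S : Type*} [Fintype S] (π r : S → ℝ) (β : ℝ) : ℝ :=
  β * mdpVar π r - mdpMean π r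

/-- The pseudo mean-variance objective `η̃(y) = β·σ̃(y) - μ`. -/
def mdpPseudoEta {S : Type*} [Fintype S] (π r : S → ℝ) (β y : ℝ) : ℝ :=
  β * mdpPseudoVar π r y - mdpMean π r

/-- The optimal pseudo mean-variance objective `η̃*(y) = min_{d ∈ D} η̃^d(y)`. -/
def mdpPseudoEtaStar {S D : Type*} [Fintype S] [Fintype D] [Nonempty D]
    (π r : D → S → ℝ) (β y : ℝ) : ℝ :=
  Finset.univ.inf' Finset.univ_nonempty (fun d => mdpPseudoEta (π d) (r d) β y)

/-- Decomposition of the pseudo variance: `σ̃(y) = σ + (μ - y)²`. -/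
theorem mdpPseudoVar_eq_mdpVar_add_sq {S : Type*} [Fintype S] (π r : S → ℝ)
    (hsum : ∑ i, π i = 1) (y : ℝ) :
    mdpPseudoVar π r y = mdpVar π r + (mdpMean π r - y) ^ 2 := by
  have key (z : ℝ) :
      ∑ i, π i * (r i - z) ^ 2 = ∑ i, π i * r i ^ 2 - 2 * z * mdpMean π r + z ^ 2 := by
    calc ∑ i, π i * (r i - z) ^ 2
        = ∑ i, (π i * r i ^ 2 - 2 * z * (π i * r i) + z ^ 2 * π i) :=
          Finset.sum_congr rfl fun i _ => by ring
      _ = _ := by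
          rw [Finset.sum_add_distrib, Finset.sum_sub_distrib, ← Finset.mul_sum,
            ← Finset.mul_sum, hsum, mul_one, mdpMean]
  rw [mdpPseudoVar, mdpVar, key, key]
  ring

/-- Remark 4 (dominance for pure variance minimization): if `d̃*` minimizes the pseudo
variance at `y` over all policies and `μ^d ∈ [y - |y - μ^{d̃*}|, y + |y - μ^{d̃*}|]`,
then `σ^{d̃*} ≤ σ^d`. -/
theorem variance_policy_dominance {S D : Type*} [Fintype S] [Nonempty S]
    [Fintype D] [Nonempty D]
    (π r : D → S → ℝ)
    (hπ : ∀ d i, 0 ≤ π d i) (hπsum : ∀ d, ∑ i, π d i = 1)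
    (y : ℝ) (dtil : D)
    (hopt : ∀ d : D, mdpPseudoVar (π dtil) (r dtil) y ≤ mdpPseudoVar (π d) (r d) y)
    (d : D)
    (hmem : mdpMean (π d) (r d) ∈
      Set.Icc (y - |y - mdpMean (π dtil) (r dtil)|)
              (y + |y - mdpMean (π dtil) (r dtil)|)) :
    mdpVar (π dtil) (r dtil) ≤ mdpVar (π d) (r d) := by
  have hle := hopt d
  rw [mdpPseudoVar_eq_mdpVar_add_sq _ _ (hπsum dtil),
    mdpPseudoVar_eq_mdpVar_add_sq _ _ (hπsum d)] at hle
  have habs : |mdpMean (π d) (r d) - y| ≤ |mdpMean (π dtil) (r dtil) - y| := by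
    rw [abs_sub_comm (mdpMean (π dtil) (r dtil)) y, abs_le]
    constructor <;> linarith [hmem.1, hmem.2]
  linarith [sq_le_sq.mpr habs]
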